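/- arXiv:math/0602426 — 2 statements merged into one kernel-verified Lean document; each statement's English description precedes it below -/
import Mathlib

section
/- Let φ : [0,∞) → [0,∞) satisfy φ(0) = 0 and be nondecreasing and concave on (0,∞), with a.e. derivative φ′, and assume θ_φ(y) = ∫_y^∞ φ′(t)/t dt < ∞ for every y > 0. Let (A_j)_{j≥1} be pairwise disjoint Borel subsets of (0,∞) whose union A = ∪_j A_j has finite Lebesgue measure and satisfies |A ∩ (0,ε]| = 0 for some ε > 0. Then ‖S(χ_{∪_{j≥k} A_j})‖_{Λ_φ} → 0 as k → ∞. (Hence the set function ν(A) = S(χ_A) is a countably additive vector measure on the δ-ring 𝓡 of Borel sets of finite measure bounded away from 0, with values in Λ_φ.) -/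
open MeasureTheory Set
open scoped ENNReal

/-- The Hardy operator `S f (x) = (1/x) ∫₀ˣ f(y) dy`. -/
noncomputable def S (f : ℝ → ℝ) (x : ℝ) : ℝ := (1 / x) * ∫ y in Ioo (0 : ℝ) x, f y

/-- The distribution function `λ_g(s) = |{x ∈ (0,∞) : |g(x)| > s}|`. -/
noncomputable def distFn (g : ℝ → ℝ) (s : ℝ) : ℝ≥0∞ :=
  volume {x | x ∈ Ioi (0 : ℝ) ∧ s < |g x|}

/-- `θ_φ(y) = ∫_y^∞ φ'(t)/t dt`, as a value in `[0,∞]`. -/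
noncomputable def theta (φ' : ℝ → ℝ) (y : ℝ) : ℝ≥0∞ :=
  ∫⁻ t in Ioi y, ENNReal.ofReal (φ' t / t)

/-- The natural extension of `φ` to `[0,∞]` (with `φ(∞) = sup_{t>0} φ(t)`). -/
noncomputable def PhiE (φ : ℝ → ℝ) (m : ℝ≥0∞) : ℝ≥0∞ :=
  if m = ⊤ then ⨆ t ∈ Ioi (0 : ℝ), ENNReal.ofReal (φ t) else ENNReal.ofReal (φ m.toReal)

/-- The Lorentz functional `‖g‖_{Λ_φ} = ∫₀^∞ φ(λ_g(s)) ds`. -/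
noncomputable def lorentzNorm (φ : ℝ → ℝ) (g : ℝ → ℝ) : ℝ≥0∞ :=
  ∫⁻ s in Ioi (0 : ℝ), PhiE φ (distFn g s)

/-- If `B` does not charge `(0, ε]`, the Hardy average of `χ_B` is at most `|B| / x` and vanishes
on `(0, ε]`; hence this bound on its distribution function. -/
theorem distFn_S_indicator_le {B : Set ℝ} (hB : MeasurableSet B) (hfin : volume B < ⊤)
    {ε : ℝ} (hBε : volume (B ∩ Ioc 0 ε) = 0) {s : ℝ} (hs : 0 < s) :
    distFn (fun x => S (B.indicator fun _ => (1 : ℝ)) x) s ≤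
      ENNReal.ofReal ((volume B).toReal / s - ε) := by
  rw [← Real.volume_Ioo]
  refine measure_mono ?_
  rintro x ⟨hx, hsx⟩
  have hx : 0 < x := hx
  have hS : S (B.indicator fun _ => (1 : ℝ)) x = (1 / x) * (volume (B ∩ Ioo 0 x)).toReal := by
    rw [S, integral_indicator hB, Measure.restrict_restrict hB]
    simp [Measure.real]
  beta_reduce at hsx
  rw [hS, abs_of_nonneg (by positivity)] at hsx
  have hle : (volume (B ∩ Ioo 0 x)).toReal ≤ (volume B).toReal :=
    ENNReal.toReal_mono hfin.ne (measure_mono inter_subset_left)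
  refine ⟨?_, ?_⟩
  · by_contra! h
    have h0 : volume (B ∩ Ioo 0 x) = 0 :=
      measure_mono_null
        (inter_subset_inter_right _ (Ioo_subset_Ioc_self.trans (Ioc_subset_Ioc_right h))) hBε
    rw [h0] at hsx
    simp at hsx
    linarith
  · rw [lt_div_iff₀ hs]
    rw [one_div, inv_mul_eq_div, lt_div_iff₀ hx] at hsx
    linarith

theorem ofReal_le_add_lintegral_deriv {φ φ' : ℝ → ℝ} {c : ℝ}
    (hφ'nn : ∀ t ∈ Ioi (0 : ℝ), 0 ≤ φ' t)
    (hφ'int : ∀ t > (0 : ℝ), IntegrableOn φ' (Ioo 0 t))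
    (hFTC : ∀ t > (0 : ℝ), φ t = c + ∫ s in Ioo (0 : ℝ) t, φ' s)
    {ε t : ℝ} (hε : 0 < ε) (ht : ε < t) :
    ENNReal.ofReal (φ t) ≤
      ENNReal.ofReal (φ ε) + ∫⁻ r in Ioo ε t, ENNReal.ofReal (φ' r) := by
  have ht0 := hε.trans ht
  have hint : IntegrableOn φ' (Ioo ε t) := (hφ'int t ht0).mono_set (Ioo_subset_Ioo_left hε.le)
  have hsplit : ∫ s in Ioo 0 t, φ' s = (∫ s in Ioo 0 ε, φ' s) + ∫ s in Ioo ε t, φ' s := by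
    rw [← Ioc_union_Ioo_eq_Ioo hε.le ht, setIntegral_union ?_ measurableSet_Ioo ?_ hint,
      integral_Ioc_eq_integral_Ioo]
    · exact Set.disjoint_left.2 fun y hy hy' => hy.2.not_gt hy'.1
    · exact (hφ'int t ht0).mono_set fun y hy => ⟨hy.1, hy.2.trans_lt ht⟩
  have heq : φ t = φ ε + ∫ s in Ioo ε t, φ' s := by
    rw [hFTC t ht0, hFTC ε hε, hsplit, add_assoc]
  rw [heq, ← ofReal_integral_eq_lintegral_ofReal hint]
  · exact ENNReal.ofReal_add_le
  · filter_upwards [ae_restrict_mem measurableSet_Ioo] with y hy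
    exact hφ'nn y (hε.trans hy.1)

theorem PhiE_le_of_le_ofReal {φ : ℝ → ℝ} (hφnn : ∀ t : ℝ, 0 ≤ t → 0 ≤ φ t) (hφ0 : φ 0 = 0)
    (hmono : MonotoneOn φ (Ioi 0)) {m : ℝ≥0∞} {a : ℝ} (ha : 0 ≤ a)
    (hm : m ≤ ENNReal.ofReal a) : PhiE φ m ≤ ENNReal.ofReal (φ a) := by
  rw [PhiE, if_neg (hm.trans_lt ENNReal.ofReal_lt_top).ne]
  refine ENNReal.ofReal_le_ofReal ?_
  have hle : m.toReal ≤ a := ENNReal.toReal_le_of_le_ofReal ha hm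
  rcases (ENNReal.toReal_nonneg (a := m)).eq_or_lt with h | h
  · rw [← h, hφ0]
    exact hφnn a ha
  · exact hmono h (h.trans_le hle) hle

/-- The Lorentz functional of the Hardy average of `χ_B` is controlled by a multiple of `|B|`. -/
theorem lorentzNorm_S_indicator_le {φ φ' : ℝ → ℝ} {c : ℝ}
    (hφnn : ∀ t : ℝ, 0 ≤ t → 0 ≤ φ t) (hφ0 : φ 0 = 0) (hmono : MonotoneOn φ (Ioi 0))
    (hφ'meas : Measurable φ') (hφ'nn : ∀ t ∈ Ioi (0 : ℝ), 0 ≤ φ' t)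
    (hφ'int : ∀ t > (0 : ℝ), IntegrableOn φ' (Ioo 0 t))
    (hFTC : ∀ t > (0 : ℝ), φ t = c + ∫ s in Ioo (0 : ℝ) t, φ' s)
    {B : Set ℝ} (hB : MeasurableSet B) (hfin : volume B < ⊤)
    {ε : ℝ} (hε : 0 < ε) (hBε : volume (B ∩ Ioc 0 ε) = 0) :
    lorentzNorm φ (fun x => S (B.indicator fun _ => (1 : ℝ)) x) ≤
      volume B * (ENNReal.ofReal (φ ε / ε) + theta φ' ε) := by
  set m := (volume B).toReal with hm
  have hm0 : 0 ≤ m := ENNReal.toReal_nonneg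
  have hvol : volume B = ENNReal.ofReal m := (ENNReal.ofReal_toReal hfin.ne).symm
  let T : Set (ℝ × ℝ) := {p | p.1 * p.2 < m}
  have hT : MeasurableSet T := (isOpen_lt (by fun_prop) continuous_const).measurableSet
  let F : ℝ → ℝ → ℝ≥0∞ := fun s r => T.indicator (fun p => ENNReal.ofReal (φ' p.2)) (s, r)
  have hF : Measurable (Function.uncurry F) :=
    (hφ'meas.ennreal_ofReal.comp measurable_snd).indicator hT
  have hpt : ∀ s ∈ Ioi (0 : ℝ), PhiE φ (distFn (fun x => S (B.indicator fun _ => (1 : ℝ)) x) s) ≤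
      (Ioo 0 (m / ε)).indicator (fun _ => ENNReal.ofReal (φ ε)) s + ∫⁻ r in Ioi ε, F s r := by
    intro s hs
    have hs : 0 < s := hs
    have hd := distFn_S_indicator_le hB hfin hBε hs
    rw [← hm] at hd
    rcases le_or_gt (m / s) ε with h | h
    · rw [ENNReal.ofReal_of_nonpos (by linarith)] at hd
      rw [nonpos_iff_eq_zero.1 hd]
      simp [PhiE, hφ0]
    · have hs' : s ∈ Ioo 0 (m / ε) := by
        refine ⟨hs, ?_⟩
        rw [lt_div_iff₀ hs] at h
        rw [lt_div_iff₀ hε]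
        linarith
      rw [indicator_of_mem hs']
      refine (PhiE_le_of_le_ofReal hφnn hφ0 hmono (by positivity)
        (hd.trans (ENNReal.ofReal_le_ofReal (by linarith)))).trans
        ((ofReal_le_add_lintegral_deriv hφ'nn hφ'int hFTC hε h).trans ?_)
      refine add_le_add_right ?_ _
      calc ∫⁻ r in Ioo ε (m / s), ENNReal.ofReal (φ' r)
          = ∫⁻ r in Ioo ε (m / s), F s r := by
            refine setLIntegral_congr_fun measurableSet_Ioo fun r hr => ?_
            have : (s, r) ∈ T := by
              have := (lt_div_iff₀ hs).1 hr.2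
              change s * r < m
              linarith
            exact (indicator_of_mem this fun p : ℝ × ℝ => ENNReal.ofReal (φ' p.2)).symm
        _ ≤ ∫⁻ r in Ioi ε, F s r := lintegral_mono_set Ioo_subset_Ioi_self
  have hinner : ∀ r ∈ Ioi ε, ∫⁻ s in Ioi (0 : ℝ), F s r =
      ENNReal.ofReal m * ENNReal.ofReal (φ' r / r) := by
    intro r hr
    have hr0 : 0 < r := hε.trans hr
    have hFr : ∀ s, F s r = (Iio (m / r)).indicator (fun _ => ENNReal.ofReal (φ' r)) s := by
      intro s
      simp only [F, T, indicator, mem_ofPred_eq, mem_Iio, lt_div_iff₀ hr0]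
    simp_rw [hFr]
    rw [lintegral_indicator_const measurableSet_Iio, Measure.restrict_apply measurableSet_Iio,
      inter_comm, Ioi_inter_Iio, Real.volume_Ioo, sub_zero,
      ← ENNReal.ofReal_mul (hφ'nn r hr0), ← ENNReal.ofReal_mul hm0]
    congr 1
    ring
  calc lorentzNorm φ (fun x => S (B.indicator fun _ => (1 : ℝ)) x)
      ≤ ∫⁻ s in Ioi (0 : ℝ), ((Ioo 0 (m / ε)).indicator (fun _ => ENNReal.ofReal (φ ε)) s
          + ∫⁻ r in Ioi ε, F s r) := setLIntegral_mono' measurableSet_Ioi hpt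
    _ = (∫⁻ s in Ioi (0 : ℝ), (Ioo 0 (m / ε)).indicator (fun _ => ENNReal.ofReal (φ ε)) s)
          + ∫⁻ s in Ioi (0 : ℝ), ∫⁻ r in Ioi ε, F s r :=
        lintegral_add_left (measurable_const.indicator measurableSet_Ioo) _
    _ = ENNReal.ofReal m * ENNReal.ofReal (φ ε / ε) + ENNReal.ofReal m * theta φ' ε := by
        congr 1
        · rw [lintegral_indicator_const measurableSet_Ioo,
            Measure.restrict_apply measurableSet_Ioo, inter_eq_left.2 Ioo_subset_Ioi_self,
            Real.volume_Ioo, sub_zero, ← ENNReal.ofReal_mul (hφnn ε hε.le),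
            ← ENNReal.ofReal_mul hm0]
          congr 1
          ring
        · rw [lintegral_lintegral_swap hF.aemeasurable,
            setLIntegral_congr_fun measurableSet_Ioi hinner, theta, lintegral_const_mul]
          exact (hφ'meas.div measurable_id).ennreal_ofReal
    _ = volume B * (ENNReal.ofReal (φ ε / ε) + theta φ' ε) := by rw [hvol, mul_add]

/-- The measures of the tails of a disjoint union of finite measure tend to zero. -/
theorem tendsto_volume_tail {A : ℕ → Set ℝ} (hAmeas : ∀ j, MeasurableSet (A j))
    (hdisj : Pairwise (Function.onFun Disjoint A)) (hAfin : volume (⋃ j, A j) < ⊤) :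
    Filter.Tendsto (fun k : ℕ => volume (⋃ j ∈ Ici k, A j)) Filter.atTop (nhds 0) := by
  have hsum : ∑' j, volume (A j) ≠ ⊤ := by
    rw [← measure_iUnion hdisj hAmeas]
    exact hAfin.ne
  refine tendsto_of_tendsto_of_tendsto_of_le_of_le tendsto_const_nhds
    (ENNReal.tendsto_sum_nat_add _ hsum) (fun _ => zero_le) fun k => ?_
  refine (measure_mono ?_).trans (measure_iUnion_le fun j => A (j + k))
  refine iUnion₂_subset fun j hj => ?_
  have := subset_iUnion (fun i => A (i + k)) (j - k)
  simpa only [Nat.sub_add_cancel (mem_Ici.1 hj)] using this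

/-- If `θ_φ(y) < ∞` for all `y > 0` and `(A_j)` are pairwise disjoint Borel subsets of `(0,∞)`
whose union has finite measure and is bounded away from `0`, then
`‖S(χ_{∪_{j ≥ k} A_j})‖_{Λ_φ} → 0` as `k → ∞`: the set function `ν(A) = S(χ_A)` is a countably
additive `Λ_φ`-valued vector measure on the δ-ring `𝓡`. -/
theorem hardy_vector_measure_countably_additive (φ φ' : ℝ → ℝ) (c : ℝ) (hc : 0 ≤ c)
    (hφnn : ∀ t : ℝ, 0 ≤ t → 0 ≤ φ t) (hφ0 : φ 0 = 0)
    (hmono : MonotoneOn φ (Ioi 0)) (hconc : ConcaveOn ℝ (Ioi 0) φ)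
    (hφ'meas : Measurable φ') (hφ'nn : ∀ t ∈ Ioi (0 : ℝ), 0 ≤ φ' t)
    (hφ'anti : AntitoneOn φ' (Ioi 0))
    (hφ'int : ∀ t > (0 : ℝ), IntegrableOn φ' (Ioo 0 t))
    (hFTC : ∀ t > (0 : ℝ), φ t = c + ∫ s in Ioo (0 : ℝ) t, φ' s)
    (hθ : ∀ y > (0 : ℝ), theta φ' y < ⊤)
    (A : ℕ → Set ℝ) (hAmeas : ∀ j, MeasurableSet (A j)) (hAsub : ∀ j, A j ⊆ Ioi 0)
    (hdisj : Pairwise (Function.onFun Disjoint A))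
    (hAfin : volume (⋃ j, A j) < ⊤)
    (hAε : ∃ ε > (0 : ℝ), volume ((⋃ j, A j) ∩ Ioc 0 ε) = 0) :
    Filter.Tendsto
      (fun k : ℕ =>
        lorentzNorm φ (fun x => S ((⋃ j ∈ Ici k, A j).indicator fun _ => (1 : ℝ)) x))
      Filter.atTop (nhds 0) := by
  obtain ⟨ε, hε, hε0⟩ := hAε
  have hsub : ∀ k : ℕ, ⋃ j ∈ Ici k, A j ⊆ ⋃ j, A j := fun k =>
    iUnion₂_subset fun j _ => subset_iUnion A j
  have hbound : ∀ k : ℕ,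
      lorentzNorm φ (fun x => S ((⋃ j ∈ Ici k, A j).indicator fun _ => (1 : ℝ)) x) ≤
        volume (⋃ j ∈ Ici k, A j) * (ENNReal.ofReal (φ ε / ε) + theta φ' ε) := fun k =>
    lorentzNorm_S_indicator_le hφnn hφ0 hmono hφ'meas hφ'nn hφ'int hFTC
      (MeasurableSet.biUnion (to_countable _) fun j _ => hAmeas j)
      ((measure_mono (hsub k)).trans_lt hAfin) hε
      (measure_mono_null (inter_subset_inter_left _ (hsub k)) hε0)
  refine tendsto_of_tendsto_of_tendsto_of_le_of_le tendsto_const_nhds ?_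
    (fun _ => zero_le) hbound
  have hK : ENNReal.ofReal (φ ε / ε) + theta φ' ε ≠ ⊤ :=
    ENNReal.add_ne_top.2 ⟨ENNReal.ofReal_ne_top, (hθ ε hε).ne⟩
  simpa using ENNReal.Tendsto.mul_const (tendsto_volume_tail hAmeas hdisj hAfin) (Or.inr hK)
end

section
/- Let φ : [0,∞) → [0,∞) be nondecreasing, concave, and continuous with φ(0) = 0, with a.e. derivative φ′, and assume θ_φ(y) = ∫_y^∞ φ′(t)/t dt < ∞ for every y > 0. Define φ_{Λ_φ}(y) = ∫₀^∞ φ′(s)/(y+s) ds. Then for every measurable f : (0,∞) → ℝ with ∫₀^∞ |f(y)|·φ_{Λ_φ}(y) dy < ∞, one has S|f| ∈ Λ_φ and ‖S|f|‖_{Λ_φ} ≤ ∫₀^∞ |f(y)|·φ_{Λ_φ}(y) dy. That is, the weighted space L¹(φ_{Λ_φ}(t) dt) embeds continuously (with constant 1) into the optimal domain [S, Λ_φ]. -/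
open MeasureTheory Set
open scoped ENNReal

/-- `φ_{Λ_φ}(y) = ∫₀^∞ φ'(s)/(y+s) ds`, as a value in `[0,∞]`. -/
noncomputable def phiLambda (φ' : ℝ → ℝ) (y : ℝ) : ℝ≥0∞ :=
  ∫⁻ s in Ioi (0 : ℝ), ENNReal.ofReal (φ' s / (y + s))

theorem exists_measurable_subset_volume_eq {D : Set ℝ} (hD : MeasurableSet D) {p q : ℝ}
    (hDpq : D ⊆ Ioc p q) {b : ℝ≥0∞} (hb : b ≤ volume D) :
    ∃ C ⊆ D, MeasurableSet C ∧ volume C = b := by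
  have hfin (R : ℝ) : volume (D ∩ Iic R) ≠ ⊤ :=
    measure_ne_top_of_subset (inter_subset_left.trans hDpq) measure_Ioc_lt_top.ne
  have hDfin : volume D ≠ ⊤ := measure_ne_top_of_subset hDpq measure_Ioc_lt_top.ne
  have hlip : LipschitzWith 1 fun R => (volume (D ∩ Iic R)).toReal := by
    refine LipschitzWith.of_le_add fun R R' => ?_
    have hsub : D ∩ Iic R ⊆ (D ∩ Iic R') ∪ Ioc R' R := by
      rintro x ⟨hx, hxR⟩
      rcases le_or_gt x R' with h | h
      · exact Or.inl ⟨hx, h⟩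
      · exact Or.inr ⟨h, hxR⟩
    have h1 : volume (D ∩ Iic R) ≤ volume (D ∩ Iic R') + ENNReal.ofReal (dist R R') := by
      refine (measure_mono hsub).trans ((measure_union_le _ _).trans ?_)
      rw [Real.volume_Ioc]
      gcongr
      exact le_abs_self _
    have h2 := ENNReal.toReal_mono (by simp [hfin]) h1
    rwa [ENNReal.toReal_add (hfin _) ENNReal.ofReal_ne_top,
      ENNReal.toReal_ofReal dist_nonneg] at h2
  have hp : volume (D ∩ Iic p) = 0 := by
    have : D ∩ Iic p = ∅ := by
      ext x
      simp only [mem_inter_iff, mem_Iic, mem_empty_iff_false, iff_false, not_and, not_le]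
      exact fun hx => (hDpq hx).1
    simp [this]
  have hq : D ∩ Iic q = D := inter_eq_left.2 fun x hx => (hDpq hx).2
  rcases le_or_gt p q with hpq | hpq
  · have hivt := intermediate_value_Icc hpq hlip.continuous.continuousOn
    simp only [hp, hq, ENNReal.toReal_zero] at hivt
    obtain ⟨R, -, hR⟩ := hivt ⟨ENNReal.toReal_nonneg, ENNReal.toReal_mono hDfin hb⟩
    exact ⟨D ∩ Iic R, inter_subset_left, hD.inter measurableSet_Iic,
      (ENNReal.toReal_eq_toReal_iff' (hfin R) (ne_top_of_le_ne_top hDfin hb)).1 hR⟩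
  · have hD0 : D = ∅ := subset_empty_iff.1 (hDpq.trans (Ioc_eq_empty hpq.not_gt).subset)
    refine ⟨D, Subset.rfl, hD, ?_⟩
    simp only [hD0, measure_empty] at hb ⊢
    exact (nonpos_iff_eq_zero.1 hb).symm

/-- A set of measure at most `a` on which `g` is as large as possible. -/
theorem exists_measurableSet_min_le_volume_inter {X : Set ℝ} (hX : MeasurableSet X) {p q : ℝ}
    (hXpq : X ⊆ Ioc p q) {g : ℝ → ℝ} (hg : Measurable g) (a : ℝ≥0∞) :
    ∃ E ⊆ X, MeasurableSet E ∧ volume E ≤ a ∧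
      ∀ s, min (volume (X ∩ {x | s < g x})) a ≤ volume (E ∩ {x | s < g x}) := by
  rcases le_or_gt (volume X) a with hXa | hXa
  · exact ⟨X, Subset.rfl, hX, hXa, fun s => min_le_left _ _⟩
  rcases eq_zero_or_pos a with rfl | ha
  · exact ⟨∅, empty_subset _, MeasurableSet.empty, by simp, fun s => by simp⟩
  have hXfin : volume X ≠ ⊤ := measure_ne_top_of_subset hXpq measure_Ioc_lt_top.ne
  have hmeas (s : ℝ) : MeasurableSet (X ∩ {x | s < g x}) :=
    hX.inter (measurableSet_lt measurable_const hg)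
  have hfin (s : ℝ) : volume (X ∩ {x | s < g x}) ≠ ⊤ :=
    measure_ne_top_of_subset inter_subset_left hXfin
  have hanti : Antitone fun s : ℝ => X ∩ {x | s < g x} := fun s t hst x hx =>
    ⟨hx.1, hst.trans_lt hx.2⟩
  set T : Set ℝ := {s | volume (X ∩ {x | s < g x}) ≤ a} with hT
  have hTne : T.Nonempty := by
    have hlim := tendsto_measure_iInter_atTop (μ := volume)
      (s := fun n : ℕ => X ∩ {x | (n : ℝ) < g x})
      (fun n => (hmeas n).nullMeasurableSet) (fun m n hmn => hanti (Nat.cast_le.2 hmn))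
      ⟨0, hfin _⟩
    have hemp : ⋂ n : ℕ, X ∩ {x | (n : ℝ) < g x} = ∅ := by
      refine eq_empty_of_forall_notMem fun x hx => ?_
      obtain ⟨n, hn⟩ := exists_nat_ge (g x)
      exact hn.not_gt (mem_iInter.1 hx n).2
    rw [hemp, measure_empty] at hlim
    obtain ⟨n, hn⟩ := (hlim.eventually_le_const ha).exists
    exact ⟨n, hn⟩
  have hTbdd : BddBelow T := by
    have hlim := tendsto_measure_iUnion_atTop (μ := volume)
      (s := fun n : ℕ => X ∩ {x | -(n : ℝ) < g x})
      (fun m n hmn => hanti (neg_le_neg (Nat.cast_le.2 hmn)))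
    have huniv : ⋃ n : ℕ, X ∩ {x | -(n : ℝ) < g x} = X := by
      refine Subset.antisymm (iUnion_subset fun n => inter_subset_left) fun x hx => ?_
      obtain ⟨n, hn⟩ := exists_nat_gt (-g x)
      exact mem_iUnion.2 ⟨n, hx, neg_lt.1 hn⟩
    rw [huniv] at hlim
    obtain ⟨n, hn⟩ := (hlim.eventually_const_lt hXa).exists
    refine ⟨-n, fun s hs => ?_⟩
    by_contra! h
    exact (hn.trans_le (measure_mono (hanti h.le))).not_ge hs
  set s₀ := sInf T with hs₀
  have hup {s : ℝ} (hs : s₀ < s) : s ∈ T := by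
    obtain ⟨t, ht, hts⟩ := (csInf_lt_iff hTbdd hTne).1 hs
    exact (measure_mono (hanti hts.le)).trans ht
  have hlow {s : ℝ} (hs : s < s₀) : a ≤ volume (X ∩ {x | s < g x}) := by
    by_contra! h
    exact hs.not_ge (csInf_le hTbdd h.le)
  set U := X ∩ {x | s₀ < g x} with hU
  set V := X ∩ {x | s₀ ≤ g x} with hV
  have hUa : volume U ≤ a := by
    have hlim := tendsto_measure_iUnion_atTop (μ := volume)
      (s := fun n : ℕ => X ∩ {x | s₀ + 1 / ((n : ℝ) + 1) < g x})
      (fun m n hmn => hanti (by gcongr))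
    have hUeq : ⋃ n : ℕ, X ∩ {x | s₀ + 1 / ((n : ℝ) + 1) < g x} = U := by
      refine Subset.antisymm (iUnion_subset fun n => hanti ?_) fun x hx => ?_
      · have : 0 < 1 / ((n : ℝ) + 1) := by positivity
        linarith
      · obtain ⟨n, hn⟩ := exists_nat_one_div_lt (K := ℝ) (sub_pos.2 (show s₀ < g x from hx.2))
        exact mem_iUnion.2 ⟨n, hx.1, by simp only [mem_ofPred_eq]; linarith⟩
    rw [hUeq] at hlim
    refine le_of_tendsto' hlim fun n => hup ?_
    have : 0 < 1 / ((n : ℝ) + 1) := by positivity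
    linarith
  have hVa : a ≤ volume V := by
    have hlim := tendsto_measure_iInter_atTop (μ := volume)
      (s := fun n : ℕ => X ∩ {x | s₀ - 1 / ((n : ℝ) + 1) < g x})
      (fun n => (hmeas _).nullMeasurableSet) (fun m n hmn => hanti (by gcongr))
      ⟨0, hfin _⟩
    have hVeq : ⋂ n : ℕ, X ∩ {x | s₀ - 1 / ((n : ℝ) + 1) < g x} = V := by
      refine Subset.antisymm (fun x hx => ?_) (subset_iInter fun n x hx => ⟨hx.1, ?_⟩)
      · rw [mem_iInter] at hx
        refine ⟨(hx 0).1, ?_⟩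
        by_contra h
        replace h : g x < s₀ := not_le.1 h
        obtain ⟨n, hn⟩ := exists_nat_one_div_lt (K := ℝ) (sub_pos.2 h)
        have := (hx n).2
        simp only [mem_ofPred_eq] at this
        linarith
      · have : 0 < 1 / ((n : ℝ) + 1) := by positivity
        have := hx.2
        simp only [mem_ofPred_eq] at this ⊢
        linarith
    rw [hVeq] at hlim
    refine ge_of_tendsto' hlim fun n => hlow ?_
    have : 0 < 1 / ((n : ℝ) + 1) := by positivity
    linarith
  have hUV : U ⊆ V := fun x hx => ⟨hx.1, (show s₀ < g x from hx.2).le⟩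
  have hVm : MeasurableSet V := hX.inter (measurableSet_le measurable_const hg)
  have hUm : MeasurableSet U := hmeas s₀
  obtain ⟨C, hCD, hCm, hC⟩ := exists_measurable_subset_volume_eq (hVm.diff hUm)
    (sdiff_subset.trans (inter_subset_left.trans hXpq)) (b := a - volume U) (by
      rw [measure_sdiff hUV hUm.nullMeasurableSet (hfin s₀)]
      gcongr)
  have hE : volume (U ∪ C) = a := by
    rw [measure_union (disjoint_sdiff_right.mono_right hCD) hCm, hC, add_tsub_cancel_of_le hUa]
  have hEV : U ∪ C ⊆ V := union_subset hUV (hCD.trans sdiff_subset)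
  refine ⟨U ∪ C, hEV.trans inter_subset_left, hUm.union hCm, hE.le, fun s => ?_⟩
  rcases le_or_gt s₀ s with hs | hs
  · refine (min_le_left _ _).trans (measure_mono fun x hx => ⟨Or.inl ?_, hx.2⟩)
    exact hanti hs hx
  · refine (min_le_right _ _).trans (hE.ge.trans (measure_mono fun x hx => ⟨hx, ?_⟩))
    exact hs.trans_le (hEV hx).2

theorem lintegral_min_volume_le {g : ℝ → ℝ} (hg : Measurable g) (hg0 : ∀ x ∈ Ioi (0 : ℝ), 0 ≤ g x)
    {a C : ℝ≥0∞}
    (h : ∀ E ⊆ Ioi (0 : ℝ), MeasurableSet E → volume E ≤ a →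
      ∫⁻ x in E, ENNReal.ofReal (g x) ≤ C) :
    ∫⁻ s in Ioi (0 : ℝ), min (volume (Ioi 0 ∩ {x | s < g x})) a ≤ C := by
  have hlt (s : ℝ) : MeasurableSet {x | s < g x} := measurableSet_lt measurable_const hg
  have hmono (s : ℝ) : Monotone fun n : ℕ => Ioc (0 : ℝ) n ∩ {x | s < g x} := fun m n hmn =>
    inter_subset_inter_left _ (Ioc_subset_Ioc_right (Nat.cast_le.2 hmn))
  have hunion (s : ℝ) : ⋃ n : ℕ, Ioc (0 : ℝ) n ∩ {x | s < g x} = Ioi 0 ∩ {x | s < g x} := by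
    rw [← iUnion_inter]
    congr 1
    refine Subset.antisymm (iUnion_subset fun n => Ioc_subset_Ioi_self) fun x hx => ?_
    obtain ⟨n, hn⟩ := exists_nat_ge x
    exact mem_iUnion.2 ⟨n, hx, hn⟩
  have hsup (s : ℝ) : min (volume (Ioi 0 ∩ {x | s < g x})) a
      = ⨆ n : ℕ, min (volume (Ioc (0 : ℝ) n ∩ {x | s < g x})) a := by
    rw [← hunion s, (hmono s).measure_iUnion]
    exact iSup_inf_eq _ _
  simp_rw [hsup]
  rw [lintegral_iSup]
  · refine iSup_le fun n => ?_
    obtain ⟨E, hEX, hEm, hEa, hE⟩ := exists_measurableSet_min_le_volume_inter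
      (X := Ioc (0 : ℝ) n) measurableSet_Ioc Subset.rfl hg a
    have hE0 : E ⊆ Ioi 0 := hEX.trans Ioc_subset_Ioi_self
    refine le_trans ?_ (h E hE0 hEm hEa)
    rw [lintegral_eq_lintegral_meas_lt _
      (ae_restrict_of_forall_mem hEm fun x hx => hg0 x (hE0 hx)) hg.aemeasurable]
    refine lintegral_mono fun s => ?_
    rw [Measure.restrict_apply (hlt s), inter_comm _ E]
    exact hE s
  · refine fun n => Antitone.measurable fun s t hst => ?_
    refine min_le_min_right _ (measure_mono fun x hx => ⟨hx.1, hst.trans_lt hx.2⟩)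
  · exact fun m n hmn s => min_le_min_right _ (measure_mono (hmono s hmn))

theorem setLIntegral_inv_le_of_volume_le {E A : Set ℝ} (hE : MeasurableSet E)
    (hA : MeasurableSet A) (hA0 : A ⊆ Ioi 0) (hAdown : ∀ t ∈ A, ∀ s, 0 < s → s < t → s ∈ A)
    (hEA : volume E ≤ volume A) {y : ℝ} (hy : 0 ≤ y) :
    ∫⁻ x in E ∩ Ioi y, ENNReal.ofReal (1 / x) ≤ ∫⁻ t in A, ENNReal.ofReal (1 / (y + t)) := by
  have hm₁ : Measurable fun x : ℝ => 1 / x := by fun_prop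
  have hm₂ : Measurable fun t : ℝ => 1 / (y + t) := by fun_prop
  rw [lintegral_eq_lintegral_meas_lt _ (ae_restrict_of_forall_mem (hE.inter measurableSet_Ioi)
      fun x hx => one_div_nonneg.2 (hy.trans (le_of_lt hx.2))) hm₁.aemeasurable,
    lintegral_eq_lintegral_meas_lt _ (ae_restrict_of_forall_mem hA
      fun t ht => one_div_nonneg.2 (add_nonneg hy (le_of_lt (hA0 ht)))) hm₂.aemeasurable]
  refine lintegral_mono fun u => ?_
  rw [Measure.restrict_apply (measurableSet_lt measurable_const hm₁),
    Measure.restrict_apply (measurableSet_lt measurable_const hm₂)]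
  by_cases hAL : A ⊆ {t | u < 1 / (y + t)}
  · rw [inter_eq_right.2 hAL]
    exact (measure_mono fun x hx => hx.2.1).trans hEA
  · obtain ⟨t, htA, htL⟩ := not_subset.1 hAL
    simp only [mem_ofPred_eq, not_lt] at htL
    calc volume ({x | u < 1 / x} ∩ (E ∩ Ioi y))
        ≤ volume ({x | u < 1 / x} ∩ Ioi y) := measure_mono fun x hx => ⟨hx.1, hx.2.2⟩
      _ = volume ((fun s => y + s) ⁻¹' ({x | u < 1 / x} ∩ Ioi y)) :=
        (measure_preimage_add _ _ _).symm
      _ ≤ volume ({t | u < 1 / (y + t)} ∩ A) := by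
        refine measure_mono fun s hs => ⟨hs.1, ?_⟩
        have hs0 : 0 < s := by simpa using hs.2
        refine hAdown t htA s hs0 ?_
        by_contra! hts
        have ht0 : 0 < t := hA0 htA
        have h1 : 1 / (y + s) ≤ 1 / (y + t) := by gcongr
        exact (htL.trans_lt hs.1).not_ge h1

theorem lintegral_volume_superlevel (φ' : ℝ → ℝ) (hφ' : Measurable φ')
    (hφ'nn : ∀ t ∈ Ioi (0 : ℝ), 0 ≤ φ' t) {w : ℝ → ℝ≥0∞} (hw : Measurable w) :
    ∫⁻ r in Ioi (0 : ℝ), ∫⁻ t in {t | r < φ' t} ∩ Ioi 0, w t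
      = ∫⁻ t in Ioi (0 : ℝ), w t * ENNReal.ofReal (φ' t) := by
  have hμ : (volume.restrict (Ioi (0 : ℝ))).withDensity w ≪ volume.restrict (Ioi 0) :=
    withDensity_absolutelyContinuous _ _
  have h := lintegral_eq_lintegral_meas_lt ((volume.restrict (Ioi (0 : ℝ))).withDensity w)
    (hμ.ae_le (ae_restrict_of_forall_mem measurableSet_Ioi hφ'nn)) hφ'.aemeasurable
  rw [lintegral_withDensity_eq_lintegral_mul _ hw hφ'.ennreal_ofReal] at h
  simp only [Pi.mul_apply] at h
  rw [h]
  refine lintegral_congr fun r => ?_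
  have hr : MeasurableSet {t | r < φ' t} := measurableSet_lt measurable_const hφ'
  rw [withDensity_apply _ hr, Measure.restrict_restrict hr]

theorem PhiE_le_lintegral_min {φ φ' : ℝ → ℝ} (hφ0 : φ 0 = 0) (hφ'meas : Measurable φ')
    (hφ'nn : ∀ t ∈ Ioi (0 : ℝ), 0 ≤ φ' t)
    (hFTC : ∀ t > (0 : ℝ),
      ENNReal.ofReal (φ t) = ∫⁻ s in Ioo (0 : ℝ) t, ENNReal.ofReal (φ' s)) (m : ℝ≥0∞) :
    PhiE φ m ≤ ∫⁻ r in Ioi (0 : ℝ), min m (volume ({t | r < φ' t} ∩ Ioi 0)) := by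
  have key {t : ℝ} (ht : 0 < t) (htm : ENNReal.ofReal t ≤ m) :
      ENNReal.ofReal (φ t) ≤ ∫⁻ r in Ioi (0 : ℝ), min m (volume ({t | r < φ' t} ∩ Ioi 0)) := by
    rw [hFTC t ht, lintegral_eq_lintegral_meas_lt _
      (ae_restrict_of_forall_mem measurableSet_Ioo fun s hs => hφ'nn s hs.1)
      hφ'meas.aemeasurable]
    refine lintegral_mono fun r => ?_
    rw [Measure.restrict_apply (measurableSet_lt measurable_const hφ'meas)]
    refine le_min ((measure_mono inter_subset_right).trans ?_)
      (measure_mono (inter_subset_inter_right _ Ioo_subset_Ioi_self))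
    simpa using htm
  unfold PhiE
  split_ifs with hm
  · exact iSup₂_le fun t ht => key ht (by simp [hm])
  · rcases (ENNReal.toReal_nonneg (a := m)).eq_or_lt with h0 | h0
    · simp [← h0, hφ0]
    · exact key h0 (ENNReal.ofReal_toReal hm).le

theorem S_abs_eq {f : ℝ → ℝ} (hf : Measurable f) (x : ℝ) :
    S (fun y => |f y|) x = 1 / x * (∫⁻ y in Ioo (0 : ℝ) x, ENNReal.ofReal |f y|).toReal := by
  rw [S, integral_eq_lintegral_of_nonneg_ae (Filter.Eventually.of_forall fun y => abs_nonneg _)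
    (by fun_prop)]

theorem measurable_S_abs {f : ℝ → ℝ} (hf : Measurable f) :
    Measurable (S fun y => |f y|) := by
  have hmono : Monotone fun x => ∫⁻ y in Ioo (0 : ℝ) x, ENNReal.ofReal |f y| := fun x x' h =>
    lintegral_mono_set (Ioo_subset_Ioo_right h)
  rw [funext (S_abs_eq hf)]
  exact (measurable_const.div measurable_id).mul hmono.measurable.ennreal_toReal

theorem S_abs_nonneg (f : ℝ → ℝ) {x : ℝ} (hx : 0 ≤ x) : 0 ≤ S (fun y => |f y|) x :=
  mul_nonneg (one_div_nonneg.2 hx) (integral_nonneg fun _ => abs_nonneg _)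

theorem setLIntegral_S_abs_le {f : ℝ → ℝ} (hf : Measurable f) {E A : Set ℝ}
    (hE : MeasurableSet E) (hE0 : E ⊆ Ioi 0)
    (hA : MeasurableSet A) (hA0 : A ⊆ Ioi 0) (hAdown : ∀ t ∈ A, ∀ s, 0 < s → s < t → s ∈ A)
    (hEA : volume E ≤ volume A) :
    ∫⁻ x in E, ENNReal.ofReal (S (fun y => |f y|) x)
      ≤ ∫⁻ y in Ioi (0 : ℝ), ENNReal.ofReal |f y| * ∫⁻ t in A, ENNReal.ofReal (1 / (y + t)) := by
  have hF : Measurable fun y => ENNReal.ofReal |f y| := by fun_prop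
  let k : ℝ → ℝ → ℝ≥0∞ := fun x y =>
    (Iio x).indicator (fun y => ENNReal.ofReal |f y| * ENNReal.ofReal (1 / x)) y
  have hk : Measurable (Function.uncurry k) := by
    have hset : MeasurableSet {p : ℝ × ℝ | p.2 < p.1} :=
      measurableSet_lt measurable_snd measurable_fst
    have hm : Measurable fun p : ℝ × ℝ => ENNReal.ofReal |f p.2| * ENNReal.ofReal (1 / p.1) := by
      fun_prop
    exact hm.indicator hset
  calc ∫⁻ x in E, ENNReal.ofReal (S (fun y => |f y|) x)
      ≤ ∫⁻ x in E, ∫⁻ y in Ioi (0 : ℝ), k x y := by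
        refine setLIntegral_mono' hE fun x hx => ?_
        rw [S_abs_eq hf, ENNReal.ofReal_mul (one_div_nonneg.2 (le_of_lt (hE0 hx))), mul_comm,
          lintegral_indicator measurableSet_Iio, Measure.restrict_restrict measurableSet_Iio,
          inter_comm, Ioi_inter_Iio, lintegral_mul_const _ hF]
        gcongr
        exact ENNReal.ofReal_toReal_le
    _ = ∫⁻ y in Ioi (0 : ℝ), ∫⁻ x in E, k x y := lintegral_lintegral_swap hk.aemeasurable
    _ ≤ _ := by
        refine setLIntegral_mono' measurableSet_Ioi fun y hy => ?_
        have hky (x : ℝ) : k x y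
            = (Ioi y).indicator (fun x => ENNReal.ofReal |f y| * ENNReal.ofReal (1 / x)) x := by
          simp only [k, indicator, mem_Iio, mem_Ioi]
        simp_rw [hky]
        rw [lintegral_indicator measurableSet_Ioi, Measure.restrict_restrict measurableSet_Ioi,
          inter_comm, lintegral_const_mul _ (by fun_prop)]
        refine mul_le_mul_right ?_ _
        exact setLIntegral_inv_le_of_volume_le hE hA hA0 hAdown hEA (le_of_lt hy)

theorem lorentzNorm_S_abs_le {φ φ' : ℝ → ℝ} (hφ0 : φ 0 = 0) (hφ'meas : Measurable φ')
    (hφ'nn : ∀ t ∈ Ioi (0 : ℝ), 0 ≤ φ' t) (hφ'anti : AntitoneOn φ' (Ioi 0))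
    (hFTC : ∀ t > (0 : ℝ),
      ENNReal.ofReal (φ t) = ∫⁻ s in Ioo (0 : ℝ) t, ENNReal.ofReal (φ' s))
    {f : ℝ → ℝ} (hf : Measurable f) :
    lorentzNorm φ (fun x => S (fun y => |f y|) x)
      ≤ ∫⁻ y in Ioi (0 : ℝ), ENNReal.ofReal |f y| * phiLambda φ' y := by
  set g : ℝ → ℝ := S fun y => |f y| with hg
  have hgm : Measurable g := measurable_S_abs hf
  let A : ℝ → Set ℝ := fun r => {t | r < φ' t} ∩ Ioi 0
  have hAm (r : ℝ) : MeasurableSet (A r) :=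
    (measurableSet_lt measurable_const hφ'meas).inter measurableSet_Ioi
  have hA0 (r : ℝ) : A r ⊆ Ioi 0 := inter_subset_right
  have hAdown (r : ℝ) : ∀ t ∈ A r, ∀ s, 0 < s → s < t → s ∈ A r := fun t ht s hs hst =>
    ⟨lt_of_lt_of_le ht.1 (hφ'anti hs ht.2 hst.le), hs⟩
  have hdist (s : ℝ) : distFn (fun x => S (fun y => |f y|) x) s
      = volume (Ioi 0 ∩ {x | s < g x}) := by
    refine congrArg volume (Set.ext fun x => and_congr_right fun hx => ?_)
    rw [abs_of_nonneg (S_abs_nonneg f (le_of_lt hx))]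
    rfl
  have hmin : Measurable fun p : ℝ × ℝ =>
      min (volume (Ioi 0 ∩ {x | p.1 < g x})) (volume (A p.2)) := by
    have h1 : Antitone fun s : ℝ => volume (Ioi 0 ∩ {x | s < g x}) := fun s t hst =>
      measure_mono fun x hx => ⟨hx.1, hst.trans_lt hx.2⟩
    have h2 : Antitone fun r : ℝ => volume (A r) := fun s t hst =>
      measure_mono fun x hx => ⟨hst.trans_lt hx.1, hx.2⟩
    exact (h1.measurable.comp measurable_fst).min (h2.measurable.comp measurable_snd)
  let K : ℝ → ℝ → ℝ≥0∞ := fun r y => ∫⁻ t in A r, ENNReal.ofReal (1 / (y + t))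
  have hK : Measurable (Function.uncurry K) := by
    have hset : MeasurableSet {q : (ℝ × ℝ) × ℝ | q.1.1 < φ' q.2 ∧ 0 < q.2} :=
      by
      refine MeasurableSet.inter (s₁ := {q : (ℝ × ℝ) × ℝ | q.1.1 < φ' q.2})
        (s₂ := {q : (ℝ × ℝ) × ℝ | 0 < q.2}) ?_ ?_
      · exact measurableSet_lt (by fun_prop) (by fun_prop)
      · exact measurableSet_lt (by fun_prop) (by fun_prop)
    have hm : Measurable fun q : (ℝ × ℝ) × ℝ => ENNReal.ofReal (1 / (q.1.2 + q.2)) := by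
      fun_prop
    have hKeq : Function.uncurry K = fun p : ℝ × ℝ => ∫⁻ t,
        {q : (ℝ × ℝ) × ℝ | q.1.1 < φ' q.2 ∧ 0 < q.2}.indicator
          (fun q => ENNReal.ofReal (1 / (q.1.2 + q.2))) (p, t) := by
      ext ⟨r, y⟩
      exact (lintegral_indicator (hAm r) _).symm
    rw [hKeq]
    exact (hm.indicator hset).lintegral_prod_right'
  calc lorentzNorm φ (fun x => S (fun y => |f y|) x)
      ≤ ∫⁻ s in Ioi (0 : ℝ), ∫⁻ r in Ioi (0 : ℝ),
          min (volume (Ioi 0 ∩ {x | s < g x})) (volume (A r)) := by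
        refine lintegral_mono fun s => ?_
        rw [hdist]
        exact PhiE_le_lintegral_min hφ0 hφ'meas hφ'nn hFTC _
    _ = ∫⁻ r in Ioi (0 : ℝ), ∫⁻ s in Ioi (0 : ℝ),
          min (volume (Ioi 0 ∩ {x | s < g x})) (volume (A r)) :=
        lintegral_lintegral_swap hmin.aemeasurable
    _ ≤ ∫⁻ r in Ioi (0 : ℝ), ∫⁻ y in Ioi (0 : ℝ), ENNReal.ofReal |f y| * K r y :=
        lintegral_mono fun r => lintegral_min_volume_le hgm
          (fun x hx => S_abs_nonneg f (le_of_lt hx)) fun E hE0 hEm hEa =>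
            setLIntegral_S_abs_le hf hEm hE0 (hAm r) (hA0 r) (hAdown r) hEa
    _ = ∫⁻ y in Ioi (0 : ℝ), ∫⁻ r in Ioi (0 : ℝ), ENNReal.ofReal |f y| * K r y :=
        lintegral_lintegral_swap (Measurable.aemeasurable
          (((hf.comp measurable_snd).abs.ennreal_ofReal).mul hK))
    _ = ∫⁻ y in Ioi (0 : ℝ), ENNReal.ofReal |f y| * phiLambda φ' y := by
        refine setLIntegral_congr_fun measurableSet_Ioi fun y hy => ?_
        have hKy : Measurable fun r => K r y := hK.comp measurable_prodMk_right
        rw [lintegral_const_mul _ hKy,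
          lintegral_volume_superlevel φ' hφ'meas hφ'nn (by fun_prop), phiLambda]
        congr 1
        refine setLIntegral_congr_fun measurableSet_Ioi fun t ht => ?_
        rw [← ENNReal.ofReal_mul (one_div_nonneg.2 (add_pos hy ht).le), one_div_mul_eq_div]

/-- For `φ` nondecreasing, concave, continuous with `φ(0) = 0`, a.e. derivative `φ'`, and
`θ_φ` finite: if `∫₀^∞ |f(y)|·φ_{Λ_φ}(y) dy < ∞`, then `S|f| ∈ Λ_φ` and
`‖S|f|‖_{Λ_φ} ≤ ∫₀^∞ |f(y)|·φ_{Λ_φ}(y) dy`: the weighted space `L¹(φ_{Λ_φ}(t) dt)` embeds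
with constant 1 into the optimal domain `[S, Λ_φ]`. -/
theorem weighted_L1_subset_hardy_domain (φ φ' : ℝ → ℝ)
    (hmono : MonotoneOn φ (Ici 0)) (hconc : ConcaveOn ℝ (Ici 0) φ)
    (hcont : ContinuousOn φ (Ici 0)) (hφ0 : φ 0 = 0)
    (hφ'meas : Measurable φ') (hφ'nn : ∀ t ∈ Ioi (0 : ℝ), 0 ≤ φ' t)
    (hφ'anti : AntitoneOn φ' (Ioi 0))
    (hFTC : ∀ t > (0 : ℝ),
      ENNReal.ofReal (φ t) = ∫⁻ s in Ioo (0 : ℝ) t, ENNReal.ofReal (φ' s))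
    (hθ : ∀ y > (0 : ℝ), theta φ' y < ⊤)
    (f : ℝ → ℝ) (hfmeas : Measurable f)
    (hf : (∫⁻ y in Ioi (0 : ℝ), ENNReal.ofReal |f y| * phiLambda φ' y) < ⊤) :
    lorentzNorm φ (fun x => S (fun y => |f y|) x) < ⊤ ∧
    lorentzNorm φ (fun x => S (fun y => |f y|) x)
      ≤ ∫⁻ y in Ioi (0 : ℝ), ENNReal.ofReal |f y| * phiLambda φ' y := by
  have h := lorentzNorm_S_abs_le hφ0 hφ'meas hφ'nn hφ'anti hFTC hfmeas
  exact ⟨h.trans_lt hf, h⟩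
end
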